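/- Let H : ℝ → Mat₂(ℂ) be a matrix-valued function whose entries are locally Lebesgue-integrable, such that for almost every k ∈ ℝ the matrix H(k) is Hermitian and positive semidefinite, and such that H(k/λ) = (1/λ)·B(k/λ)·H(k)·B(k/λ)† holds for almost every k ∈ ℝ (where † denotes the Hermitian adjoint). Then for almost every k ∈ ℝ, the rank of H(k) is at most 1. -/

import Mathlib

open MeasureTheory Filter Matrix ComplexOrder

/-- The Perron–Frobenius eigenvalue `λ = (1+√13)/2` of `M = [[1,1],[3,0]]`. -/
noncomputable def lam : ℝ := (1 + Real.sqrt 13) / 2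

/-- `p(k) = e^{2πikλ} + e^{2πik(λ+1)} + e^{2πik(λ+2)}`. -/
noncomputable def pfun (k : ℝ) : ℂ :=
  Complex.exp (((2 * Real.pi * k * lam : ℝ) : ℂ) * Complex.I) +
  Complex.exp (((2 * Real.pi * k * (lam + 1) : ℝ) : ℂ) * Complex.I) +
  Complex.exp (((2 * Real.pi * k * (lam + 2) : ℝ) : ℂ) * Complex.I)

/-- The Fourier matrix `B(k) = [[1,1],[p(k),0]]`. -/
noncomputable def Bmat (k : ℝ) : Matrix (Fin 2) (Fin 2) ℂ :=
  !![1, 1; pfun k, 0]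

lemma lam_sq : lam ^ 2 = lam + 3 := by
  have h : Real.sqrt 13 ^ 2 = 13 := Real.sq_sqrt (by norm_num)
  unfold lam; nlinarith
lemma lam_gt : 2 < lam := by
  have h : (3:ℝ) < Real.sqrt 13 := Real.lt_sqrt_of_sq_lt (by norm_num)
  unfold lam; linarith
lemma lam_lt : lam < 3 := by
  have h : Real.sqrt 13 < 5 := by
    rw [Real.sqrt_lt' (by norm_num)]; norm_num
  unfold lam; linarith

lemma pfun_ne : ∀ᵐ k : ℝ, pfun k ≠ 0 := by
  have hc : (Set.range (fun n : ℤ => (n : ℝ) / 3)).Countable := Set.countable_range _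
  filter_upwards [hc.ae_notMem volume] with k hk h0
  apply hk
  have e1 : Complex.exp (((2 * Real.pi * k * (lam + 1) : ℝ) : ℂ) * Complex.I) =
      Complex.exp (((2 * Real.pi * k * lam : ℝ) : ℂ) * Complex.I) *
      Complex.exp (((2 * Real.pi * k : ℝ) : ℂ) * Complex.I) := by
    rw [← Complex.exp_add]; congr 1; push_cast; ring
  have e2 : Complex.exp (((2 * Real.pi * k * (lam + 2) : ℝ) : ℂ) * Complex.I) =
      Complex.exp (((2 * Real.pi * k * lam : ℝ) : ℂ) * Complex.I) *
      Complex.exp (((2 * Real.pi * k : ℝ) : ℂ) * Complex.I) ^ 2 := by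
    rw [← Complex.exp_nat_mul, ← Complex.exp_add]; congr 1; push_cast; ring
  unfold pfun at h0
  rw [e1, e2] at h0
  set z := Complex.exp (((2 * Real.pi * k : ℝ) : ℂ) * Complex.I) with hz
  have h1 : Complex.exp (((2 * Real.pi * k * lam : ℝ) : ℂ) * Complex.I) * (1 + z + z ^ 2) = 0 := by
    rw [← h0]; ring
  have h2 : 1 + z + z ^ 2 = 0 := (mul_eq_zero.mp h1).resolve_left (Complex.exp_ne_zero _)
  have h3 : z ^ 3 = 1 := by linear_combination (z - 1) * h2
  rw [hz, ← Complex.exp_nat_mul, Complex.exp_eq_one_iff] at h3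
  obtain ⟨n, hn⟩ := h3
  refine ⟨n, ?_⟩
  have h4 : ((3 * k : ℝ) : ℂ) = ((n : ℝ) : ℂ) := by
    have h5 : (2 * Real.pi * Complex.I : ℂ) ≠ 0 := Complex.two_pi_I_ne_zero
    apply mul_right_cancel₀ h5
    push_cast at hn ⊢
    rw [← hn]; ring
  have h6 : 3 * k = n := by exact_mod_cast h4
  simp only; linarith

lemma pfun_sub (k : ℝ) : ‖pfun k - 3‖ ≤ 90 * |k| := by
  have key : ∀ y : ℝ, 0 ≤ y → y ≤ 5 →
      ‖Complex.exp (((2 * Real.pi * k * y : ℝ) : ℂ) * Complex.I) - 1‖ ≤ 7 * |k| * y := by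
    intro y hy _
    rw [mul_comm]
    refine (Real.norm_exp_I_mul_ofReal_sub_one_le).trans ?_
    rw [Real.norm_eq_abs, abs_mul, abs_mul, abs_of_nonneg hy, abs_of_pos (by positivity)]
    gcongr
    linarith [Real.pi_lt_d2]
  have a := key lam (by linarith [lam_gt]) (by linarith [lam_lt])
  have b := key (lam + 1) (by linarith [lam_gt]) (by linarith [lam_lt])
  have c := key (lam + 2) (by linarith [lam_gt]) (by linarith [lam_lt])
  have : pfun k - 3 = (Complex.exp (((2 * Real.pi * k * lam : ℝ) : ℂ) * Complex.I) - 1) +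
    (Complex.exp (((2 * Real.pi * k * (lam + 1) : ℝ) : ℂ) * Complex.I) - 1) +
    (Complex.exp (((2 * Real.pi * k * (lam + 2) : ℝ) : ℂ) * Complex.I) - 1) := by
    unfold pfun; ring
  rw [this]
  refine (norm_add₃_le).trans ?_
  have := lam_lt
  nlinarith [abs_nonneg k]

/-- Normalised iterates of the Perron-Frobenius vector. -/
noncomputable def xs (k : ℝ) : ℕ → Fin 2 → ℂ
  | 0 => ![1, (lam : ℂ) - 1]
  | n + 1 => (lam : ℂ)⁻¹ • (Bmat (k / lam ^ (n + 1)) *ᵥ xs k n)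

lemma xs_bound (k : ℝ) (hk : |k| ≤ 1 / 100) (n : ℕ) :
    ‖xs k n 0 - 1‖ ≤ (1 - (lam ^ n)⁻¹) / 2 ∧
    ‖xs k n 1 - ((lam : ℂ) - 1)‖ ≤ (lam - 1) * ((1 - (lam ^ n)⁻¹) / 2) := by
  have hl := lam_gt
  have hl3 := lam_lt
  have hlc : (lam : ℂ) ≠ 0 := by
    exact_mod_cast (by linarith : lam ≠ 0)
  have hsq : (lam : ℂ) ^ 2 = lam + 3 := by exact_mod_cast lam_sq
  have hnl : ‖(lam : ℂ)⁻¹‖ = lam⁻¹ := by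
    rw [norm_inv, Complex.norm_real, Real.norm_of_nonneg (by linarith)]
  induction n with
  | zero => simp [xs]
  | succ n ih =>
    obtain ⟨h0, h1⟩ := ih
    have hpos : 0 < lam ^ n := by positivity
    set u := (lam ^ n)⁻¹ with hu
    have hu0 : 0 < u := by positivity
    have hu1 : (lam ^ (n + 1))⁻¹ = u * lam⁻¹ := by rw [pow_succ, mul_inv]
    have e0 : xs k (n + 1) 0 = (lam : ℂ)⁻¹ * (xs k n 0 + xs k n 1) := by
      simp [xs, Bmat, dotProduct, Fin.sum_univ_two]
    have e1 : xs k (n + 1) 1 = (lam : ℂ)⁻¹ * (pfun (k / lam ^ (n + 1)) * xs k n 0) := by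
      simp [xs, Bmat, dotProduct, Fin.sum_univ_two]
    have hp := pfun_sub (k / lam ^ (n + 1))
    have hp2 : ‖pfun (k / lam ^ (n + 1)) - 3‖ ≤ 0.9 * (u * lam⁻¹) := by
      refine hp.trans ?_
      rw [div_eq_mul_inv, hu1, abs_mul, abs_of_pos (show 0 < u * lam⁻¹ by positivity)]
      have : 0 < u * lam⁻¹ := by positivity
      nlinarith
    rw [hu1]
    set P := pfun (k / lam ^ (n + 1))
    have hx : ‖xs k n 0‖ ≤ 3 / 2 := by
      have := norm_add_le (xs k n 0 - 1) 1
      simp only [sub_add_cancel, norm_one] at this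
      linarith
    have hli : lam⁻¹ ≤ 1 / 2 := by
      rw [inv_le_comm₀ (by linarith) (by norm_num)]; linarith
    have hli0 : 0 < lam⁻¹ := by positivity
    have hll : lam⁻¹ * lam = 1 := inv_mul_cancel₀ (by linarith)
    constructor
    · have : xs k (n + 1) 0 - 1 = (lam : ℂ)⁻¹ * ((xs k n 0 - 1) + (xs k n 1 - ((lam : ℂ) - 1))) := by
        rw [e0]; field_simp; ring
      rw [this, norm_mul, hnl]
      have h2 := norm_add_le (xs k n 0 - 1) (xs k n 1 - ((lam : ℂ) - 1))
      calc lam⁻¹ * _ ≤ lam⁻¹ * (lam * ((1 - u) / 2)) := by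
            gcongr; linarith
        _ = (1 - u) / 2 := by rw [← mul_assoc, hll, one_mul]
        _ ≤ _ := by nlinarith
    · have : xs k (n + 1) 1 - ((lam : ℂ) - 1) =
          (lam : ℂ)⁻¹ * (3 * (xs k n 0 - 1) + (P - 3) * xs k n 0) := by
        rw [e1]; field_simp; linear_combination -hsq
      rw [this, norm_mul, hnl]
      have h2 := norm_add_le (3 * (xs k n 0 - 1)) ((P - 3) * xs k n 0)
      rw [norm_mul, norm_mul] at h2
      have h3 : ‖P - 3‖ * ‖xs k n 0‖ ≤ 0.9 * (u * lam⁻¹) * (3 / 2) := by gcongr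
      have h4 : ‖(3 : ℂ)‖ = 3 := by norm_num
      rw [h4] at h2
      have h5 : lam⁻¹ * 3 = lam - 1 := by
        have := lam_sq
        field_simp; linarith
      calc lam⁻¹ * _ ≤ lam⁻¹ * (3 * ((1 - u) / 2) + 0.9 * (u * lam⁻¹) * (3 / 2)) := by
            gcongr; linarith
        _ = (lam - 1) * ((1 - u) / 2) + (lam - 1) * (0.45 * (u * lam⁻¹)) := by
            rw [← h5]; ring
        _ ≤ _ := by
            rw [← mul_add]
            refine mul_le_mul_of_nonneg_left ?_ (by linarith)
            nlinarith

lemma xs_low (k : ℝ) (hk : |k| ≤ 1 / 100) (n : ℕ) : 1 / 4 ≤ ‖xs k n 0‖ ^ 2 := by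
  have h := (xs_bound k hk n).1
  have hu0 : 0 < (lam ^ n)⁻¹ := by have := lam_gt; positivity
  have := norm_add_le (1 - xs k n 0) (xs k n 0)
  simp only [sub_add_cancel, norm_one] at this
  rw [norm_sub_rev] at this
  nlinarith


lemma rank_le_one_of_det (A : Matrix (Fin 2) (Fin 2) ℂ) (h : A.det = 0) : A.rank ≤ 1 := by
  obtain ⟨v, hv, hAv⟩ := Matrix.exists_mulVec_eq_zero_iff.mpr h
  by_contra hr
  have h2 := LinearMap.finrank_range_add_finrank_ker A.mulVecLin
  have h3 : Module.finrank ℂ (LinearMap.ker A.mulVecLin) ≠ 0 := by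
    intro h0
    have := Submodule.finrank_eq_zero.mp h0
    have hm : v ∈ LinearMap.ker A.mulVecLin := by simpa using hAv
    rw [this] at hm
    exact hv (by simpa using hm)
  have h4 : Module.finrank ℂ (LinearMap.range A.mulVecLin) = A.rank := rfl
  simp at h2
  omega

/-- The coefficient of the rank-one minorant. -/
noncomputable def gc (A : Matrix (Fin 2) (Fin 2) ℂ) : ℂ :=
  A.det / ((1 + ((lam : ℂ) - 1) ^ 2) * A.trace)

lemma minorant (A : Matrix (Fin 2) (Fin 2) ℂ) (hA : A.PosSemidef) :
    (A - gc A • vecMulVec ![1, (lam : ℂ) - 1] (star ![1, (lam : ℂ) - 1])).PosSemidef := by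
  have hN : (0 : ℂ) < 1 + ((lam : ℂ) - 1) ^ 2 := by
    have : (0 : ℝ) < 1 + (lam - 1) ^ 2 := by positivity
    exact_mod_cast this
  have ht := hA.trace_nonneg
  have hd := hA.det_nonneg
  by_cases h0 : A.trace = 0
  · have hg0 : gc A = 0 := by simp [gc, h0]
    rw [hg0, zero_smul, sub_zero]
    exact hA
  have htp : 0 < A.trace := lt_of_le_of_ne ht (Ne.symm h0)
  have hs : star ((lam : ℂ) - 1) = (lam : ℂ) - 1 := by simp
  have key : A - gc A • vecMulVec ![1, (lam : ℂ) - 1] (star ![1, (lam : ℂ) - 1]) =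
      (A.trace)⁻¹ • (A * Aᴴ) +
      gc A • vecMulVec ![(lam : ℂ) - 1, -1] (star ![(lam : ℂ) - 1, -1]) := by
    have hg : gc A * (1 + ((lam : ℂ) - 1) ^ 2) * A.trace = A.det := by
      unfold gc; field_simp
    rw [hA.1.eq]
    have h1 : A.trace • A = A * A + A.det • (1 : Matrix (Fin 2) (Fin 2) ℂ) := by
      ext i j
      fin_cases i <;> fin_cases j <;>
        simp [Matrix.mul_apply, Matrix.trace, Fin.sum_univ_two, Matrix.det_fin_two] <;> ring
    have h2 : A = (A.trace)⁻¹ • (A * A) + (gc A * (1 + ((lam : ℂ) - 1) ^ 2)) • (1 : Matrix (Fin 2) (Fin 2) ℂ) := by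
      have : A = (A.trace)⁻¹ • (A.trace • A) := by rw [smul_smul, inv_mul_cancel₀ h0, one_smul]
      conv_lhs => rw [this, h1, smul_add, smul_smul]
      congr 2
      rw [← hg]; field_simp
    have h3 : (gc A * (1 + ((lam : ℂ) - 1) ^ 2)) • (1 : Matrix (Fin 2) (Fin 2) ℂ) =
        gc A • vecMulVec ![(lam : ℂ) - 1, -1] (star ![(lam : ℂ) - 1, -1]) +
        gc A • vecMulVec ![1, (lam : ℂ) - 1] (star ![1, (lam : ℂ) - 1]) := by
      ext i j
      fin_cases i <;> fin_cases j <;> simp [vecMulVec] <;> ring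
    rw [sub_eq_iff_eq_add, add_assoc, ← h3]
    exact h2
  rw [key]
  refine PosSemidef.add ?_ ?_
  · exact (posSemidef_self_mul_conjTranspose A).smul (inv_nonneg.mpr ht)
  · refine (posSemidef_vecMulVec_self_star _).smul ?_
    exact div_nonneg hd (mul_nonneg hN.le ht)

lemma orbit_minorant (H : ℝ → Matrix (Fin 2) (Fin 2) ℂ) (k : ℝ) (hp : (H k).PosSemidef)
    (hren : ∀ n : ℕ, H (k / lam ^ (n + 1)) = (lam : ℂ)⁻¹ •
      (Bmat (k / lam ^ (n + 1)) * H (k / lam ^ n) * (Bmat (k / lam ^ (n + 1)))ᴴ)) (n : ℕ) :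
    (H (k / lam ^ n) - ((lam : ℂ) ^ n * gc (H k)) •
      vecMulVec (xs k n) (star (xs k n))).PosSemidef := by
  have hl : 0 < lam := by linarith [lam_gt]
  have hlc : (lam : ℂ) ≠ 0 := by exact_mod_cast hl.ne'
  induction n with
  | zero => simpa [xs] using minorant (H k) hp
  | succ n ih =>
    have h1 := (ih.mul_mul_conjTranspose_same (Bmat (k / lam ^ (n + 1)))).smul
      (show (0 : ℂ) ≤ (lam : ℂ)⁻¹ by
        have : (0 : ℝ) ≤ lam⁻¹ := by positivity
        exact_mod_cast this)
    convert h1 using 1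
    rw [hren n, mul_sub, sub_mul, smul_sub]
    congr 1
    rw [Matrix.mul_smul, Matrix.smul_mul, smul_smul, Matrix.mul_vecMulVec,
      Matrix.vecMulVec_mul, xs, star_smul, vecMulVec_smul, smul_vecMulVec, smul_smul, smul_smul,
      Matrix.star_mulVec]
    congr 1
    simp
    field_simp
    ring

lemma orbit_ineq (H : ℝ → Matrix (Fin 2) (Fin 2) ℂ) (k : ℝ) (hk : |k| ≤ 1 / 100)
    (hp : (H k).PosSemidef)
    (hren : ∀ n : ℕ, H (k / lam ^ (n + 1)) = (lam : ℂ)⁻¹ •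
      (Bmat (k / lam ^ (n + 1)) * H (k / lam ^ n) * (Bmat (k / lam ^ (n + 1)))ᴴ)) (n : ℕ) :
    (gc (H k)).re / 4 ≤ (lam ^ n)⁻¹ * (H (k / lam ^ n) 0 0).re := by
  have h := (orbit_minorant H k hp hren n).diag_nonneg (i := 0)
  have hl : 0 < lam := by linarith [lam_gt]
  have hg : 0 ≤ (gc (H k)).re := by
    have h0 : 0 ≤ gc (H k) := by
      have hN : (0 : ℂ) < 1 + ((lam : ℂ) - 1) ^ 2 := by
        have : (0 : ℝ) < 1 + (lam - 1) ^ 2 := by positivity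
        exact_mod_cast this
      exact div_nonneg hp.det_nonneg (mul_nonneg hN.le hp.trace_nonneg)
    exact (Complex.nonneg_iff.mp h0).1
  have hx := xs_low k hk n
  have e : ((lam : ℂ) ^ n * gc (H k)) • vecMulVec (xs k n) (star (xs k n)) 0 0 =
      ((lam ^ n * ‖xs k n 0‖ ^ 2 : ℝ) : ℂ) * gc (H k) := by
    simp only [vecMulVec_apply, Pi.star_apply, smul_eq_mul]
    have : xs k n 0 * star (xs k n 0) = ((‖xs k n 0‖ ^ 2 : ℝ) : ℂ) := by
      rw [Complex.star_def, Complex.mul_conj, Complex.normSq_eq_norm_sq]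
    rw [this]; push_cast; ring
  rw [Matrix.sub_apply, Matrix.smul_apply, e] at h
  have h2 := (Complex.nonneg_iff.mp h).1
  rw [Complex.sub_re, Complex.re_ofReal_mul] at h2
  rw [inv_mul_eq_div, le_div_iff₀ (by positivity)]
  have : 0 < lam ^ n := by positivity
  nlinarith [mul_nonneg (mul_nonneg this.le hg) (sub_nonneg.mpr hx)]

lemma det_eq_zero_of_gc (A : Matrix (Fin 2) (Fin 2) ℂ) (hA : A.PosSemidef)
    (h : (gc A).re ≤ 0) : A.det = 0 := by
  have hN : (0 : ℂ) < 1 + ((lam : ℂ) - 1) ^ 2 := by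
    have : (0 : ℝ) < 1 + (lam - 1) ^ 2 := by positivity
    exact_mod_cast this
  have h0 : 0 ≤ gc A := div_nonneg hA.det_nonneg (mul_nonneg hN.le hA.trace_nonneg)
  have h1 : gc A = 0 := by
    obtain ⟨a, b⟩ := Complex.nonneg_iff.mp h0
    exact Complex.ext (le_antisymm h a) b.symm
  rcases div_eq_zero_iff.mp h1 with h2 | h2
  · exact h2
  · rcases mul_eq_zero.mp h2 with h3 | h3
    · exact absurd h3 hN.ne'
    · rw [hA.trace_eq_zero_iff.mp h3]; simp

lemma qmp_div (a : ℝ) (ha : a ≠ 0) :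
    Measure.QuasiMeasurePreserving (fun k : ℝ => k / a) volume volume := by
  refine ⟨by fun_prop, ?_⟩
  have := Real.map_volume_mul_right (inv_ne_zero ha)
  simp only [div_eq_mul_inv]
  rw [this]
  exact Measure.smul_absolutelyContinuous

theorem stmt4 (H : ℝ → Matrix (Fin 2) (Fin 2) ℂ)
    (hloc : ∀ i j : Fin 2, LocallyIntegrable (fun k => H k i j) volume)
    (hherm : ∀ᵐ k : ℝ, (H k).IsHermitian ∧ (H k).PosSemidef)
    (hren : ∀ᵐ k : ℝ,
      H (k / lam) = (lam : ℂ)⁻¹ • (Bmat (k / lam) * H k * (Bmat (k / lam))ᴴ)) :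
    ∀ᵐ k : ℝ, (H k).rank ≤ 1 := by
  have hl2 := lam_gt
  have hl : 0 < lam := by linarith
  have hlc : (lam : ℂ) ≠ 0 := by exact_mod_cast hl.ne'
  have hrenall : ∀ᵐ k : ℝ, ∀ n : ℕ, H (k / lam ^ (n + 1)) = (lam : ℂ)⁻¹ •
      (Bmat (k / lam ^ (n + 1)) * H (k / lam ^ n) * (Bmat (k / lam ^ (n + 1)))ᴴ) := by
    rw [ae_all_iff]
    intro n
    have := (qmp_div (lam ^ n) (by positivity)).ae hren
    filter_upwards [this] with k hk
    rw [pow_succ, ← div_div]; exact hk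
  set K : Set ℝ := Set.Icc (-(1 / 100)) (1 / 100) with hK
  set F : ℝ → ENNReal := fun k => ENNReal.ofReal (H k 0 0).re with hF
  set G : ℝ → ENNReal := fun k => ENNReal.ofReal ((gc (H k)).re / 4) with hG
  have hm : ∀ i j, AEMeasurable (fun k => H k i j) volume := fun i j =>
    (hloc i j).aestronglyMeasurable.aemeasurable
  have hGm : AEMeasurable G volume := by
    have h00 := hm 0 0
    have h01 := hm 0 1
    have h10 := hm 1 0
    have h11 := hm 1 1
    simp only [hG, gc, Matrix.det_fin_two, Matrix.trace_fin_two]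
    refine ENNReal.measurable_ofReal.comp_aemeasurable (AEMeasurable.div_const ?_ _)
    refine Complex.measurable_re.comp_aemeasurable ?_
    exact ((h00.mul h11).sub (h01.mul h10)).div ((h00.add h11).const_mul _)
  have hFfin : ∫⁻ k in K, F k ≠ ⊤ := by
    have h1 : IntegrableOn (fun k => H k 0 0) K volume :=
      (hloc 0 0).integrableOn_isCompact isCompact_Icc
    have h2 := h1.re
    exact (h2.lintegral_lt_top).ne
  have hle : ∀ n : ℕ, ∫⁻ k in K, G k ≤
      ∫⁻ k in Set.Icc (-(1 / 100) / lam ^ n) ((1 / 100) / lam ^ n), F k := by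
    intro n
    have hpos : 0 < lam ^ n := by positivity
    have hch := lintegral_image_eq_lintegral_abs_deriv_mul (s := K)
      (f := fun k => k / lam ^ n) (f' := fun _ => 1 / lam ^ n) measurableSet_Icc
      (fun x _ => ((hasDerivAt_id x).div_const _).hasDerivWithinAt)
      (fun x _ y _ hxy => by
        simp only at hxy
        field_simp at hxy; exact hxy) F
    have hsub : (fun k => k / lam ^ n) '' K ⊆
        Set.Icc (-(1 / 100) / lam ^ n) ((1 / 100) / lam ^ n) := by
      rintro _ ⟨x, hx, rfl⟩
      constructor
      · exact div_le_div_of_nonneg_right hx.1 hpos.le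
      · exact div_le_div_of_nonneg_right hx.2 hpos.le
    refine le_trans ?_ (lintegral_mono_set hsub)
    rw [hch]
    refine setLIntegral_mono_ae' measurableSet_Icc ?_
    filter_upwards [hherm, hrenall] with k hk1 hk2 hkK
    rw [← ENNReal.ofReal_mul (abs_nonneg _), abs_of_pos (by positivity), one_div]
    exact ENNReal.ofReal_le_ofReal (orbit_ineq H k (abs_le.mpr hkK) hk1.2 hk2 n)
  have hpinv : Tendsto (fun n : ℕ => (lam ^ n)⁻¹) atTop (nhds 0) :=
    tendsto_inv_atTop_zero.comp (tendsto_pow_atTop_atTop_of_one_lt (by linarith))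
  have hzero : ∫⁻ k in K, G k = 0 := by
    have ht := tendsto_setLIntegral_zero (μ := volume.restrict K) hFfin (l := atTop)
      (s := fun n : ℕ => Set.Icc (-(1 / 100) / lam ^ n) ((1 / 100) / lam ^ n)) (by
        have hv : Tendsto (fun n : ℕ => ENNReal.ofReal ((1 / 50) * (lam ^ n)⁻¹)) atTop (nhds 0) := by
          have := ENNReal.tendsto_ofReal (hpinv.const_mul (1 / 50))
          simpa using this
        refine tendsto_of_tendsto_of_tendsto_of_le_of_le tendsto_const_nhds hv
          (fun _ => zero_le) (fun n => ?_)
        refine (Measure.restrict_le_self _).trans ?_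
        rw [Real.volume_Icc]
        exact ENNReal.ofReal_le_ofReal (le_of_eq (by ring)))
    refine le_antisymm (ge_of_tendsto' ht (fun n => ?_)) zero_le
    rw [Measure.restrict_restrict_of_subset]
    · exact hle n
    · have h1 : 1 ≤ lam ^ n := one_le_pow₀ (by linarith)
      refine Set.Icc_subset_Icc ?_ (div_le_self (by norm_num) h1)
      rw [neg_div]
      exact neg_le_neg (div_le_self (by norm_num) h1)
  have hGz : ∀ᵐ k : ℝ, k ∈ K → G k = 0 := by
    rw [lintegral_eq_zero_iff' hGm.restrict] at hzero
    exact (ae_restrict_iff' measurableSet_Icc).mp hzero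
  have hdet : ∀ᵐ k : ℝ, k ∈ K → (H k).det = 0 := by
    filter_upwards [hGz, hherm] with k hk h1 hkK
    refine det_eq_zero_of_gc _ h1.2 ?_
    have := ENNReal.ofReal_eq_zero.mp (hk hkK)
    linarith
  have hdetall : ∀ᵐ k : ℝ, ∀ n : ℕ, k / lam ^ n ∈ K → (H (k / lam ^ n)).det = 0 :=
    ae_all_iff.mpr fun n => (qmp_div (lam ^ n) (by positivity)).ae hdet
  have hpall : ∀ᵐ k : ℝ, ∀ n : ℕ, pfun (k / lam ^ n) ≠ 0 :=
    ae_all_iff.mpr fun n => (qmp_div (lam ^ n) (by positivity)).ae pfun_ne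
  filter_upwards [hdetall, hpall, hrenall] with k hk1 hk2 hk3
  apply rank_le_one_of_det
  have hback : ∀ n : ℕ, (H (k / lam ^ n)).det = 0 → (H k).det = 0 := by
    intro n
    induction n with
    | zero => simp
    | succ n ih =>
      intro h
      apply ih
      rw [hk3 n, Matrix.det_smul, Matrix.det_mul, Matrix.det_mul, Matrix.det_conjTranspose] at h
      have hB : (Bmat (k / lam ^ (n + 1))).det ≠ 0 := by
        simpa [Bmat, Matrix.det_fin_two] using hk2 (n + 1)
      have hB' : star (Bmat (k / lam ^ (n + 1))).det ≠ 0 := by simpa using hB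
      simpa [hB, hB', hlc] using h
  have hlim : Tendsto (fun n : ℕ => k / lam ^ n) atTop (nhds 0) := by
    simpa [div_eq_mul_inv] using hpinv.const_mul k
  obtain ⟨n, hn⟩ := (hlim.eventually (Icc_mem_nhds (show (-(1 / 100) : ℝ) < 0 by norm_num)
    (show (0 : ℝ) < 1 / 100 by norm_num))).exists
  exact hback n (hk1 n hn)
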